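/- Let k be a field, R = k[x_0,…,x_N], and let 1 ≤ h ≤ N and n ≥ h be integers. Let F_1,…,F_n ∈ R be homogeneous polynomials such that any subset of at most h+1 of them forms a complete intersection (i.e., a regular sequence on R), and let I = ⋂_{1 ≤ i_1 < … < i_h ≤ n} (F_{i_1},…,F_{i_h}) be the defining ideal of the corresponding codimension-h star configuration. Then the Demailly-like bound holds for I: for all integers n', m ≥ 1 one has (m+h−1) · α(I^{(n')}) ≥ n' · (α(I^{(m)}) + h − 1), i.e., α(I^{(n')})/n' ≥ (α(I^{(m)}) + h − 1)/(m+h−1). -/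

import Mathlib

/-- The `n`-th symbolic power of an ideal `I`:
`f ∈ I^{(n)}` iff for every associated prime `P` of `R/I` there is `s ∉ P` with `s*f ∈ I^n`.
(For a prime ideal `I` this is exactly `{f | ∃ s ∉ I, s*f ∈ I^n} = Iⁿ R_I ∩ R`.) -/
def symbolicPower {R : Type*} [CommRing R] (I : Ideal R) (n : ℕ) : Ideal R where
  carrier := {f | ∀ P ∈ associatedPrimes R (R ⧸ I), ∃ s, s ∉ P ∧ s * f ∈ I ^ n}
  zero_mem' := by
    intro P hP
    exact ⟨1, fun h => hP.1.ne_top ((Ideal.eq_top_iff_one P).mpr h), by simp⟩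
  add_mem' := by
    intro a b ha hb P hP
    obtain ⟨s, hs, hsa⟩ := ha P hP
    obtain ⟨t, ht, htb⟩ := hb P hP
    refine ⟨s * t, fun h => ((hP.1.mem_or_mem h).elim hs ht), ?_⟩
    have heq : s * t * (a + b) = t * (s * a) + s * (t * b) := by ring
    rw [heq]
    exact Ideal.add_mem _ (Ideal.mul_mem_left _ _ hsa) (Ideal.mul_mem_left _ _ htb)
  smul_mem' := by
    intro r a ha P hP
    obtain ⟨s, hs, hsa⟩ := ha P hP
    refine ⟨s, hs, ?_⟩
    have heq : s * (r • a) = r * (s * a) := by rw [smul_eq_mul]; ring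
    rw [heq]
    exact Ideal.mul_mem_left _ _ hsa

/-- `α(J)`: the least degree of a nonzero homogeneous element of `J`. -/
noncomputable def alphaDeg {k : Type*} [CommSemiring k] {σ : Type*}
    (J : Ideal (MvPolynomial σ k)) : ℕ :=
  sInf {d | ∃ f ∈ J, f ≠ 0 ∧ MvPolynomial.IsHomogeneous f d}

/-- `s` is a nonzerodivisor modulo `I`. -/
def Ideal.IsRegularMod {A : Type*} [CommRing A] (I : Ideal A) (s : A) : Prop :=
  ∀ g, s * g ∈ I → g ∈ I

/-- Modulo `K`, each `F i` with `i ∈ S` is a nonzerodivisor modulo the ideal generated by any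
subfamily of `S` not containing `i`; equivalently, every ordering of `S` is a weakly regular
sequence modulo `K`. -/
def IsPermutablyRegular {A ι : Type*} [CommRing A] (F : ι → A) (S : Finset ι) (K : Ideal A) :
    Prop :=
  ∀ T ⊆ S, ∀ i ∈ S, i ∉ T → (Ideal.span (F '' T) ⊔ K).IsRegularMod (F i)

section PermutablyRegular

variable {A ι : Type*} [CommRing A] {F : ι → A}

lemma IsPermutablyRegular.mono {S T : Finset ι} {K : Ideal A} (h : IsPermutablyRegular F S K)
    (hT : T ⊆ S) : IsPermutablyRegular F T K :=
  fun U hU i hi hiU => h U (hU.trans hT) i (hT hi) hiU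

variable [DecidableEq ι]

lemma span_image_insert (F : ι → A) (x : ι) (S : Finset ι) :
    Ideal.span (F '' (insert x S : Finset ι)) = Ideal.span (F '' S) ⊔ Ideal.span {F x} := by
  rw [Finset.coe_insert, Set.image_insert_eq, Ideal.span_insert, sup_comm]

lemma IsPermutablyRegular.of_insert {x : ι} {S : Finset ι} {K : Ideal A} (hx : x ∉ S)
    (h : IsPermutablyRegular F (insert x S) K) :
    IsPermutablyRegular F S (K ⊔ Ideal.span {F x}) := by
  intro T hT i hi hiT
  have := h (insert x T) (Finset.insert_subset_insert x hT) i (Finset.mem_insert_of_mem hi)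
    (by
      rw [Finset.mem_insert, not_or]
      exact ⟨fun e => hx (e ▸ hi), hiT⟩)
  rwa [span_image_insert, sup_assoc, sup_comm (Ideal.span {F x})] at this

lemma Ideal.sup_span_singleton_pow_succ_le (J : Ideal A) (x : A) (n : ℕ) :
    (J ⊔ Ideal.span {x}) ^ (n + 1) ≤
      J ^ (n + 1) ⊔ Ideal.span {x} * (J ⊔ Ideal.span {x}) ^ n := by
  induction n with
  | zero => simp
  | succ n ih =>
    rw [pow_succ' _ (n + 1), Ideal.sup_mul]
    refine sup_le ((Ideal.mul_mono_right ih).trans ?_) le_sup_right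
    rw [Ideal.mul_sup, ← pow_succ']
    refine sup_le_sup_left ?_ _
    rw [mul_left_comm, pow_succ' _ n]
    exact Ideal.mul_mono_right (Ideal.mul_mono_left le_sup_left)

lemma Ideal.sup_span_singleton_pow_le (J : Ideal A) (x : A) (n : ℕ) :
    (J ⊔ Ideal.span {x}) ^ n ≤ J ^ n ⊔ Ideal.span {x} := by
  cases n with
  | zero => simp
  | succ n =>
    exact (J.sup_span_singleton_pow_succ_le x n).trans (sup_le_sup_left Ideal.mul_le_left _)

/-- Cancelling one of the generators lowers the exponent by one, provided that this generator
stays regular modulo powers of the ideal generated by the others. -/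
lemma mem_pow_sup_of_mul_mem_pow_succ_sup {J K : Ideal A} {x f : A} {n : ℕ}
    (hx : (J ^ (n + 1) ⊔ K).IsRegularMod x)
    (hf : x * f ∈ (J ⊔ Ideal.span {x}) ^ (n + 1) ⊔ K) :
    f ∈ (J ⊔ Ideal.span {x}) ^ n ⊔ K := by
  have h1 := sup_le_sup_right (J.sup_span_singleton_pow_succ_le x n) K hf
  rw [sup_right_comm] at h1
  obtain ⟨c, hc, d, hd, hcd⟩ := Submodule.mem_sup.1 h1
  obtain ⟨g, hg, rfl⟩ := Ideal.mem_span_singleton_mul.1 hd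
  have h2 : f - g ∈ J ^ (n + 1) ⊔ K := hx _ (by
    rw [mul_sub, ← hcd, add_sub_cancel_right]
    exact hc)
  have h3 : J ^ (n + 1) ⊔ K ≤ (J ⊔ Ideal.span {x}) ^ n ⊔ K :=
    sup_le_sup_right ((Ideal.pow_le_pow_right n.le_succ).trans
      (Ideal.pow_right_mono le_sup_left n)) K
  simpa using add_mem (h3 h2) (le_sup_left (a := (J ⊔ Ideal.span {x}) ^ n) (b := K) hg)

theorem IsPermutablyRegular.isRegularMod_pow {S : Finset ι} {K : Ideal A} {s : A}
    (hS : IsPermutablyRegular F S K) (hs : (Ideal.span (F '' S) ⊔ K).IsRegularMod s) (n : ℕ) :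
    (Ideal.span (F '' S) ^ n ⊔ K).IsRegularMod s := by
  induction S using Finset.induction_on generalizing K s n with
  | empty =>
    cases n with
    | zero => simp [Ideal.IsRegularMod]
    | succ n => simpa using hs
  | insert x S hx ih =>
    have hxn (n : ℕ) : (Ideal.span (F '' S) ^ n ⊔ K).IsRegularMod (F x) :=
      ih (hS.mono (Finset.subset_insert x S))
        (hS S (Finset.subset_insert x S) x (Finset.mem_insert_self x S) hx) n
    rw [span_image_insert] at hs ⊢
    induction n with
    | zero => simp [Ideal.IsRegularMod]
    | succ n ihn =>
      intro f hf
      have hs' : (Ideal.span (F '' S) ⊔ (K ⊔ Ideal.span {F x})).IsRegularMod s := by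
        rwa [sup_comm K, ← sup_assoc]
      have h1 := ih (hS.of_insert hx) hs' (n + 1) f (by
        rw [sup_comm K, ← sup_assoc]
        exact sup_le_sup_right (Ideal.sup_span_singleton_pow_le _ _ _) K hf)
      rw [← sup_assoc] at h1
      obtain ⟨c, hc, d, hd, rfl⟩ := Submodule.mem_sup.1 h1
      obtain ⟨g, rfl⟩ := Ideal.mem_span_singleton'.1 hd
      have hc' : c ∈ (Ideal.span (F '' S) ⊔ Ideal.span {F x}) ^ (n + 1) ⊔ K :=
        sup_le_sup_right (Ideal.pow_right_mono le_sup_left _) K hc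
      have h2 : F x * (s * g) ∈ (Ideal.span (F '' S) ⊔ Ideal.span {F x}) ^ (n + 1) ⊔ K := by
        have := sub_mem hf (Ideal.mul_mem_left _ s hc')
        rwa [mul_add, add_sub_cancel_left, ← mul_assoc, mul_comm] at this
      have h3 := ihn g (mem_pow_sup_of_mul_mem_pow_succ_sup (hxn _) h2)
      refine add_mem hc' ?_
      obtain ⟨u, hu, v, hv, rfl⟩ := Submodule.mem_sup.1 h3
      rw [add_mul]
      refine add_mem (Ideal.mem_sup_left ?_) (Ideal.mem_sup_right (Ideal.mul_mem_right _ _ hv))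
      rw [pow_succ]
      exact Ideal.mul_mem_mul hu (Ideal.mem_sup_right (Ideal.mem_span_singleton_self _))

end PermutablyRegular

section StarConfiguration

/-- Every subfamily of `F` of at most `h + 1` members is a weakly regular sequence in any order. -/
def IsStarFamily {A ι : Type*} [CommRing A] (F : ι → A) (h : ℕ) : Prop :=
  ∀ T : Finset ι, T.card ≤ h → ∀ i ∉ T, (Ideal.span (F '' T)).IsRegularMod (F i)

/-- The ideal of the codimension `h` star configuration on the family `F`. -/
def starIdeal {A ι : Type*} [CommRing A] (F : ι → A) (h : ℕ) : Ideal A :=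
  ⨅ (S : Finset ι) (_ : S.card = h), Ideal.span (F '' ↑S)

variable {A ι : Type*} [CommRing A] {F : ι → A} {h : ℕ}

lemma starIdeal_le {S : Finset ι} (hS : S.card = h) : starIdeal F h ≤ Ideal.span (F '' S) :=
  iInf₂_le S hS

lemma mem_starIdeal {x : A} :
    x ∈ starIdeal F h ↔ ∀ S : Finset ι, S.card = h → x ∈ Ideal.span (F '' S) := by
  simp [starIdeal]

lemma mem_associatedPrimes_quotient_iff [IsNoetherianRing A] {I P : Ideal A} :
    P ∈ associatedPrimes A (A ⧸ I) ↔ P.IsPrime ∧ ∃ x, ∀ r, r ∈ P ↔ r * x ∈ I := by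
  rw [AssociatedPrimes.mem_iff, isAssociatedPrime_iff]
  refine and_congr_right fun _ => ?_
  rw [Ideal.Quotient.mk_surjective.exists]
  refine exists_congr fun x => ?_
  rw [Ideal.ext_iff]
  refine forall_congr' fun r => iff_congr Iff.rfl ?_
  rw [Submodule.mem_colon_singleton, Submodule.mem_bot, Algebra.smul_def,
    Ideal.Quotient.algebraMap_eq, ← map_mul, Ideal.Quotient.eq_zero_iff_mem]

lemma exists_isRegularMod_of_forall_not_le [IsNoetherianRing A] {I C : Ideal A}
    (hC : ∀ P ∈ associatedPrimes A (A ⧸ I), ¬ C ≤ P) : ∃ s ∈ C, I.IsRegularMod s := by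
  by_contra! hcon
  have hsub : (C : Set A) ⊆ ⋃ P ∈ associatedPrimes A (A ⧸ I), ((id P : Ideal A) : Set A) := by
    intro s hs
    have h1 := hcon s hs
    simp only [Ideal.IsRegularMod, not_forall] at h1
    obtain ⟨g, hg, hgI⟩ := h1
    have h2 := biUnion_associatedPrimes_eq_zero_divisors A (A ⧸ I)
    simp only [id]
    rw [h2]
    refine ⟨Ideal.Quotient.mk I g, fun h0 => hgI (Ideal.Quotient.eq_zero_iff_mem.1 h0), ?_⟩
    rw [Algebra.smul_def, Ideal.Quotient.algebraMap_eq, ← map_mul,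
      Ideal.Quotient.eq_zero_iff_mem]
    exact hg
  obtain ⟨P, hP, hCP⟩ := (Ideal.subset_union_prime_finite (associatedPrimes.finite A (A ⧸ I))
    (f := id) 0 0 fun P hP _ _ => hP.1).1 hsub
  exact hC P hP hCP

lemma not_mem_of_isRegularMod {J P : Ideal A} {x y : A} (hP : P ≠ ⊤)
    (hx : ∀ r, r ∈ P ↔ r * x ∈ J) (hy : J.IsRegularMod y) : y ∉ P := fun hyP =>
  hP ((Ideal.eq_top_iff_one P).2 ((hx 1).2 (by simpa using hy x ((hx y).1 hyP))))

/-- Every associated prime of a star configuration is an associated prime of a component. -/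
lemma exists_component_of_mem_associatedPrimes [Fintype ι] [IsNoetherianRing A] {P : Ideal A}
    (hP : P ∈ associatedPrimes A (A ⧸ starIdeal F h)) :
    ∃ S : Finset ι, S.card = h ∧ ∃ x, ∀ r, r ∈ P ↔ r * x ∈ Ideal.span (F '' S) := by
  rw [mem_associatedPrimes_quotient_iff] at hP
  obtain ⟨hP, x, hx⟩ := hP
  have key : ∃ S : Finset ι, S.card = h ∧ ∀ r, r * x ∈ Ideal.span (F '' S) → r ∈ P := by
    by_contra! hcon
    choose! r hr hrP using hcon
    have hprod : ∏ S ∈ Finset.univ.filter (fun S : Finset ι => S.card = h), r S ∈ P := by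
      rw [hx, mem_starIdeal]
      intro S hS
      refine Ideal.mem_of_dvd _ (mul_dvd_mul_right (Finset.dvd_prod_of_mem r ?_) x) (hr S hS)
      simpa using hS
    obtain ⟨S, hS, hSP⟩ := hP.prod_mem_iff.1 hprod
    exact hrP S (by simpa using hS) hSP
  obtain ⟨S, hS, hr⟩ := key
  exact ⟨S, hS, x, fun r => ⟨fun h => starIdeal_le hS ((hx r).1 h), hr r⟩⟩

lemma prod_pow_mem_span_pow [Fintype ι] (b : ι → ℕ) {S : Finset ι} {m : ℕ} (hb : m ≤ ∑ i ∈ S, b i) :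
    ∏ i, F i ^ b i ∈ Ideal.span (F '' S) ^ m := by
  refine Ideal.mem_of_dvd _
    (Finset.prod_dvd_prod_of_subset S Finset.univ (fun i => F i ^ b i) (Finset.subset_univ S)) ?_
  refine Ideal.pow_le_pow_right hb ?_
  rw [← Finset.prod_pow_eq_pow_sum]
  exact Ideal.prod_mem_prod fun i hi =>
    Ideal.pow_mem_pow (Ideal.subset_span (Set.mem_image_of_mem F hi)) _

variable [DecidableEq ι]

lemma IsStarFamily.isPermutablyRegular (hF : IsStarFamily F h) {S U : Finset ι}
    (hSU : Disjoint S U) (hcard : S.card + U.card ≤ h + 1) :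
    IsPermutablyRegular F S (Ideal.span (F '' U)) := by
  intro T hT i hi hiT
  rw [← Ideal.span_union, ← Set.image_union, ← Finset.coe_union]
  have hiU : i ∉ U := Finset.disjoint_left.1 hSU hi
  have hlt : T.card < S.card := Finset.card_lt_card
    ⟨hT, fun hST => hiT (hST hi)⟩
  refine hF _ ?_ i (by simp [hiT, hiU])
  have := Finset.card_union_le T U
  omega

variable [Fintype ι]

/-- The product of the members of the family outside `S` lies in every component ideal of the
star configuration other than the one of `S`. -/
lemma prod_compl_mem_span {S T : Finset ι} (hcard : T.card = S.card) (hST : T ≠ S) :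
    ∏ j ∈ Sᶜ, F j ∈ Ideal.span (F '' T) := by
  have : ∃ j ∈ T, j ∉ S := by
    by_contra! hsub
    exact hST (Finset.eq_of_subset_of_card_le hsub hcard.ge)
  obtain ⟨j, hjT, hjS⟩ := this
  exact Ideal.mem_of_dvd _ (Finset.dvd_prod_of_mem F (Finset.mem_compl.2 hjS))
    (Ideal.subset_span ⟨j, hjT, rfl⟩)

lemma IsStarFamily.prod_compl_not_mem (hF : IsStarFamily F h) {S : Finset ι} (hS : S.card = h)
    {P : Ideal A} (hP : P.IsPrime) {x : A} (hx : ∀ r, r ∈ P ↔ r * x ∈ Ideal.span (F '' S)) :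
    ∏ j ∈ Sᶜ, F j ∉ P := by
  rw [hP.prod_mem_iff]
  rintro ⟨j, hj, hjP⟩
  exact not_mem_of_isRegularMod hP.ne_top hx (hF S hS.le j (Finset.mem_compl.1 hj)) hjP

/-- The associated primes of a component of a star configuration are associated primes of the
star configuration. -/
lemma IsStarFamily.associatedPrimes_subset [IsNoetherianRing A] (hF : IsStarFamily F h)
    {S : Finset ι} (hS : S.card = h) :
    associatedPrimes A (A ⧸ Ideal.span (F '' S)) ⊆ associatedPrimes A (A ⧸ starIdeal F h) := by
  intro P hP
  rw [mem_associatedPrimes_quotient_iff] at hP ⊢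
  obtain ⟨hP, x, hx⟩ := hP
  refine ⟨hP, (∏ j ∈ Sᶜ, F j) * x, fun r => ⟨fun hr => ?_, fun hr => ?_⟩⟩
  · rw [mem_starIdeal]
    intro T hT
    by_cases hTS : T = S
    · subst hTS
      rw [mul_left_comm]
      exact Ideal.mul_mem_left _ _ ((hx r).1 hr)
    · exact Ideal.mul_mem_left _ _ (Ideal.mul_mem_right _ _
        (prod_compl_mem_span (hT.trans hS.symm) hTS))
  · have h1 := starIdeal_le hS hr
    rw [← mul_assoc, ← hx] at h1
    exact (hP.mem_or_mem h1).resolve_right (hF.prod_compl_not_mem hS hP hx)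

theorem IsStarFamily.symbolicPower_le [IsNoetherianRing A] (hF : IsStarFamily F h)
    {S : Finset ι} (hS : S.card = h) (n : ℕ) :
    symbolicPower (starIdeal F h) n ≤ Ideal.span (F '' S) ^ n := by
  intro f hf
  let C : Ideal A := Submodule.colon (starIdeal F h ^ n) {f}
  obtain ⟨s, hsC, hs⟩ : ∃ s ∈ C, (Ideal.span (F '' S)).IsRegularMod s := by
    refine exists_isRegularMod_of_forall_not_le fun P hP hCP => ?_
    obtain ⟨s, hsP, hsf⟩ := hf P (hF.associatedPrimes_subset hS hP)
    exact hsP (hCP (Submodule.mem_colon_singleton.2 hsf))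
  have hperm : IsPermutablyRegular F S ⊥ := by
    have := hF.isPermutablyRegular (Finset.disjoint_empty_right S) (by simp [hS])
    simpa using this
  have h1 := hperm.isRegularMod_pow (s := s) (by simpa using hs) n f
  simp only [sup_bot_eq] at h1
  exact h1 (Ideal.pow_right_mono (starIdeal_le hS) n (Submodule.mem_colon_singleton.1 hsC))

theorem IsStarFamily.prod_pow_mem_symbolicPower [IsNoetherianRing A] (hF : IsStarFamily F h)
    {m : ℕ} {b : ι → ℕ} (hb : ∀ S : Finset ι, S.card = h → m ≤ ∑ i ∈ S, b i) :
    ∏ i, F i ^ b i ∈ symbolicPower (starIdeal F h) m := by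
  intro P hP
  obtain ⟨S, hS, x, hx⟩ := exists_component_of_mem_associatedPrimes hP
  have hu := hF.prod_compl_not_mem hS hP.1 hx
  refine ⟨(∏ j ∈ Sᶜ, F j) ^ m, fun h => hu (hP.1.mem_of_pow_mem _ h), ?_⟩
  have hle : Ideal.span {∏ j ∈ Sᶜ, F j} * Ideal.span (F '' S) ≤ starIdeal F h := by
    refine le_iInf₂ fun T hT => ?_
    by_cases hTS : T = S
    · subst hTS
      exact Ideal.mul_le_right
    · refine Ideal.mul_le_left.trans ((Ideal.span_singleton_le_iff_mem _).2 ?_)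
      exact prod_compl_mem_span (hT.trans hS.symm) hTS
  refine Ideal.pow_right_mono hle m ?_
  rw [mul_pow]
  exact Ideal.mul_mem_mul (Ideal.pow_mem_pow (Ideal.mem_span_singleton_self _) m)
    (prod_pow_mem_span_pow b (hb S hS))

end StarConfiguration

section Combinatorics

variable {ι : Type*} [Fintype ι] [DecidableEq ι]

/-- If all `h`-element sums of `a` are at least `n'`, then `(m + h - 1) a` can be approximated
from below by `n' b`, with all `h`-element sums of `b` at least `m`, and with total defect at
least `n' (h - 1)`. -/
lemma exists_scaled_approximation {h m n' : ℕ} (hh : 1 ≤ h) (hcard : h ≤ Fintype.card ι)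
    (hm : 1 ≤ m) (hn' : 1 ≤ n') {a : ι → ℕ}
    (ha : ∀ S : Finset ι, S.card = h → n' ≤ ∑ i ∈ S, a i) :
    ∃ b : ι → ℕ, (∀ i, n' * b i ≤ (m + h - 1) * a i) ∧
      (∀ S : Finset ι, S.card = h → m ≤ ∑ i ∈ S, b i) ∧
      n' * (∑ i, b i + h - 1) ≤ (m + h - 1) * ∑ i, a i := by
  obtain ⟨g, rfl⟩ : ∃ g, h = g + 1 := ⟨h - 1, by omega⟩
  obtain ⟨q, rfl⟩ : ∃ q, m = q + 1 := ⟨m - 1, by omega⟩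
  have hQ : q + 1 + (g + 1) - 1 = q + g + 1 := by omega
  simp only [hQ]
  let good (b : ι → ℕ) : Prop := (∀ i, n' * b i ≤ (q + g + 1) * a i) ∧
    ∀ S : Finset ι, S.card = g + 1 → q + 1 ≤ ∑ i ∈ S, b i
  -- A small defect on `S` leaves an `h`-element sum of at least `m`.
  have sum_ge (b : ι → ℕ) (S : Finset ι) (hS : S.card = g + 1)
      (hlt : (q + g + 1) * ∑ i ∈ S, a i < n' * ∑ i ∈ S, b i + n' * (g + 1)) :
      q + 1 ≤ ∑ i ∈ S, b i := by
    have h1 := Nat.mul_le_mul_left (q + g + 1) (ha S hS)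
    by_contra! hcon
    have h2 := Nat.mul_le_mul_left n' (Nat.le_of_lt_succ hcon)
    nlinarith
  have hfloor : ∃ b, good b := by
    refine ⟨fun i => (q + g + 1) * a i / n', fun i => Nat.mul_div_le _ _, fun S hS => ?_⟩
    refine sum_ge _ S hS ?_
    rw [Finset.mul_sum, Finset.mul_sum, ← hS, mul_comm n' S.card, ← smul_eq_mul S.card,
      ← Finset.sum_const, ← Finset.sum_add_distrib]
    refine Finset.sum_lt_sum_of_nonempty (Finset.card_pos.1 (by omega)) fun i _ => ?_
    exact Nat.lt_mul_div_succ _ hn' |>.trans_eq (mul_add_one _ _)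
  obtain ⟨b, hb, hmin⟩ := WellFounded.has_min
    (InvImage.wf (fun b : ι → ℕ => ∑ i, b i) Nat.lt_wfRel.wf) {b | good b} hfloor
  refine ⟨b, hb.1, hb.2, ?_⟩
  by_contra! hcon
  obtain ⟨S₀, -, hS₀⟩ := Finset.exists_subset_card_eq (s := (Finset.univ : Finset ι)) hcard
  obtain ⟨i, hi, hbi⟩ : ∃ i ∈ S₀, b i ≠ 0 :=
    Finset.exists_ne_zero_of_sum_ne_zero (by have := hb.2 S₀ hS₀; omega)
  set b' : ι → ℕ := b - Pi.single i 1 with hb'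
  have hsum (S : Finset ι) : ∑ j ∈ S, b j ≤ ∑ j ∈ S, b' j + 1 := by
    have h1 : ∑ j ∈ S, b j ≤ ∑ j ∈ S, (b' j + (Pi.single i 1 : ι → ℕ) j) :=
      Finset.sum_le_sum fun j _ => by simp only [hb', Pi.sub_apply]; omega
    rw [Finset.sum_add_distrib] at h1
    refine h1.trans (Nat.add_le_add_left ?_ _)
    rw [Finset.sum_pi_single']
    split <;> simp
  refine hmin b' ⟨fun j => ?_, fun S hS => sum_ge _ S hS ?_⟩ ?_
  · exact (Nat.mul_le_mul_left n' (Nat.sub_le _ _)).trans (hb.1 j)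
  · have h1 : n' * ∑ j ∈ Sᶜ, b j ≤ (q + g + 1) * ∑ j ∈ Sᶜ, a j := by
      rw [Finset.mul_sum, Finset.mul_sum]
      exact Finset.sum_le_sum fun j _ => hb.1 j
    rw [← Finset.sum_add_sum_compl S a, ← Finset.sum_add_sum_compl S b] at hcon
    have h2 := Nat.mul_le_mul_left n' (hsum S)
    simp only [← add_assoc, Nat.add_sub_cancel] at hcon
    nlinarith
  · refine Finset.sum_lt_sum (fun j _ => Nat.sub_le _ _) ⟨i, Finset.mem_univ i, ?_⟩
    simp only [hb', Pi.sub_apply, Pi.single_eq_same]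
    omega

end Combinatorics

section Degree

open MvPolynomial

variable {k σ ι : Type*} [Field k] {F : ι → MvPolynomial σ k}

lemma homogeneousComponent_mem_span {d : ι → ℕ} (hd : ∀ i, (F i).IsHomogeneous (d i))
    (U : Set ι) {p : MvPolynomial σ k} (hp : p ∈ Ideal.span (F '' U)) (n : ℕ) :
    homogeneousComponent n p ∈ Ideal.span (F '' U) := by
  let _ := MvPolynomial.gradedAlgebra (σ := σ) (R := k)
  refine homogeneousComponent_mem_of_mem (Ideal.homogeneous_span _ _ ?_) hp n
  rintro _ ⟨i, -, rfl⟩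
  exact ⟨d i, hd i⟩

lemma homogeneousComponent_mul_of_left {x : MvPolynomial σ k} {d : ℕ} (hx : x.IsHomogeneous d)
    (g : MvPolynomial σ k) (e : ℕ) :
    homogeneousComponent e (x * g) =
      if d ≤ e then x * homogeneousComponent (e - d) g else 0 := by
  let _ := MvPolynomial.gradedAlgebra (σ := σ) (R := k)
  have hdec (p : MvPolynomial σ k) (n : ℕ) :
      (DirectSum.decompose (homogeneousSubmodule σ k) p n : MvPolynomial σ k) =
        homogeneousComponent n p := decomposition.decompose'_apply p n
  simpa only [hdec] using
    DirectSum.coe_decompose_mul_of_left_mem (𝒜 := homogeneousSubmodule σ k) (b := g) e hx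

lemma exists_homogeneous_factor_mod {d : ι → ℕ} (hd : ∀ i, (F i).IsHomogeneous (d i))
    {U : Set ι} {i : ι} {f : MvPolynomial σ k} {e : ℕ} (hf : f.IsHomogeneous e)
    (hfU : f ∉ Ideal.span (F '' U)) (hfi : f ∈ Ideal.span (F '' U) ⊔ Ideal.span {F i}) :
    d i ≤ e ∧ ∃ g : MvPolynomial σ k, g.IsHomogeneous (e - d i) ∧
      f - F i * g ∈ Ideal.span (F '' U) := by
  obtain ⟨c, hc, y, hy, hcy⟩ := Submodule.mem_sup.1 hfi
  obtain ⟨g, rfl⟩ := Ideal.mem_span_singleton.1 hy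
  have h1 := congrArg (homogeneousComponent e) hcy
  rw [map_add, homogeneousComponent_mul_of_left (hd i),
    homogeneousComponent_of_mem ((mem_homogeneousSubmodule e f).2 hf), if_pos rfl] at h1
  have h2 := homogeneousComponent_mem_span hd U hc e
  split_ifs at h1 with hle
  · refine ⟨hle, homogeneousComponent (e - d i) g, homogeneousComponent_isHomogeneous _ _, ?_⟩
    rwa [← h1, add_sub_cancel_right]
  · rw [add_zero] at h1
    exact absurd (h1 ▸ h2) hfU

variable [Fintype ι]

lemma isHomogeneous_prod_pow {d : ι → ℕ} (hd : ∀ i, (F i).IsHomogeneous (d i)) (b : ι → ℕ) :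
    (∏ i, F i ^ b i).IsHomogeneous (∑ i, b i * d i) :=
  IsHomogeneous.prod _ _ _ fun i _ => by simpa [mul_comm] using (hd i).pow (b i)

variable [DecidableEq ι]

/-- The degree of a form in the intersection of the ideals `(F_S) ^ (m - ∑_S a) + (F_U)`, but not
in `(F_U)`, is bounded below by the degree of a monomial in the `F i` satisfying the same
conditions. -/
theorem IsStarFamily.exists_exponents {h : ℕ} (hF : IsStarFamily F h)
    (hcard : h ≤ Fintype.card ι) {d : ι → ℕ} (hd : ∀ i, (F i).IsHomogeneous (d i))
    (hpos : ∀ i, 1 ≤ d i) (r : ℕ) (U : Finset ι) (hrU : r + U.card = h) (m e : ℕ) (a : ι → ℕ)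
    (f : MvPolynomial σ k) (hf : f.IsHomogeneous e) (hfU : f ∉ Ideal.span (F '' U))
    (hfS : ∀ S : Finset ι, Disjoint S U → S.card = r →
      f ∈ Ideal.span (F '' S) ^ (m - ∑ i ∈ S, a i) ⊔ Ideal.span (F '' U)) :
    ∃ b : ι → ℕ, ∑ i, b i * d i ≤ e ∧
      ∀ S : Finset ι, Disjoint S U → S.card = r → m ≤ ∑ i ∈ S, a i + ∑ i ∈ S, b i := by
  induction r generalizing U m e a f with
  | zero =>
    have h1 := hfS ∅ (Finset.disjoint_empty_left U) rfl
    have hm : m = 0 := by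
      by_contra hm
      simp [hm] at h1
      exact hfU h1
    exact ⟨0, by simp, fun S _ _ => by simp [hm]⟩
  | succ r ihr =>
    induction e using Nat.strong_induction_on generalizing a f with
    | _ e ihe =>
    obtain ⟨i, hiU, hmin⟩ := Finset.exists_min_image Uᶜ a (by
      rw [← Finset.card_pos, Finset.card_compl]
      omega)
    rw [Finset.mem_compl] at hiU
    by_cases hfi : f ∈ Ideal.span (F '' U) ⊔ Ideal.span {F i}
    · obtain ⟨hle, g, hg, hfg⟩ := exists_homogeneous_factor_mod hd hf hfU hfi
      have hgU : g ∉ Ideal.span (F '' U) := fun hgU =>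
        hfU (by simpa using add_mem hfg (Ideal.mul_mem_left _ (F i) hgU))
      have hsum (S : Finset ι) (c : ι → ℕ) : ∑ j ∈ S, (c + Pi.single i 1 : ι → ℕ) j =
          ∑ j ∈ S, c j + if i ∈ S then 1 else 0 := by
        simp only [Pi.add_apply, Finset.sum_add_distrib, Finset.sum_pi_single']
      obtain ⟨b, hbe, hb⟩ := ihe (e - d i) (by have := hpos i; omega) (a + Pi.single i 1) g hg hgU
        (by
          intro S hSU hS
          rw [hsum]
          have h1 : F i * g ∈
              Ideal.span (F '' S) ^ (m - ∑ j ∈ S, a j) ⊔ Ideal.span (F '' U) := by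
            have := sub_mem (hfS S hSU hS) (Ideal.mem_sup_right hfg)
            rwa [sub_sub_cancel] at this
          split_ifs with hiS
          · rw [← Nat.sub_sub]
            cases hk : m - ∑ j ∈ S, a j with
            | zero => simp
            | succ q =>
              rw [hk, ← Finset.insert_erase hiS, span_image_insert] at h1
              rw [← Finset.insert_erase hiS, span_image_insert, Nat.add_sub_cancel]
              have hc := Finset.card_erase_of_mem hiS
              have hdis : Disjoint (S.erase i) U := hSU.mono_left (Finset.erase_subset i S)
              refine mem_pow_sup_of_mul_mem_pow_succ_sup ?_ h1
              refine (hF.isPermutablyRegular hdis (by omega)).isRegularMod_pow ?_ _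
              exact hF.isPermutablyRegular hSU (by omega) _ (Finset.erase_subset i S) i hiS
                (Finset.notMem_erase i S)
          · rw [add_zero]
            refine (hF.isPermutablyRegular hSU (by omega)).isRegularMod_pow ?_ _ _ h1
            rw [← Ideal.span_union, ← Set.image_union, ← Finset.coe_union]
            refine hF _ ?_ i (by simp [hiS, hiU])
            rw [Finset.card_union_of_disjoint hSU]
            omega)
      refine ⟨b + Pi.single i 1, ?_, fun S hSU hS => ?_⟩
      · have : ∑ j, (b + Pi.single i 1 : ι → ℕ) j * d j = ∑ j, b j * d j + d i := by
          simp [add_mul, Finset.sum_add_distrib, Pi.single_apply]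
        omega
      · have := hb S hSU hS
        rw [hsum] at this ⊢
        omega
    · rw [← span_image_insert] at hfi
      obtain ⟨b, hbe, hb⟩ := ihr (insert i U) (by rw [Finset.card_insert_of_notMem hiU]; omega)
        (m - a i) e a f hf hfi (by
          intro S hSU hS
          rw [Finset.disjoint_insert_right] at hSU
          have h1 := hfS (insert i S) (Finset.disjoint_insert_left.2 ⟨hiU, hSU.2⟩)
            (by rw [Finset.card_insert_of_notMem hSU.1, hS])
          rw [Finset.sum_insert hSU.1, ← Nat.sub_sub, span_image_insert] at h1
          rw [span_image_insert, sup_comm (Ideal.span (F '' U)), ← sup_assoc]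
          exact sup_le_sup_right (Ideal.sup_span_singleton_pow_le (Ideal.span (F '' S)) (F i) _)
            (Ideal.span (F '' U)) h1)
      refine ⟨b, hbe, fun S hSU hS => ?_⟩
      obtain ⟨j, hjS, hij, hji⟩ : ∃ j ∈ S, a i ≤ a j ∧ i ∉ S.erase j := by
        by_cases hiS : i ∈ S
        · exact ⟨i, hiS, le_rfl, Finset.notMem_erase i S⟩
        · obtain ⟨j, hj⟩ := Finset.card_pos.1 (by omega : 0 < S.card)
          exact ⟨j, hj, hmin j (Finset.mem_compl.2 (Finset.disjoint_left.1 hSU hj)),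
            fun h => hiS (Finset.mem_of_mem_erase h)⟩
      have h1 := hb (S.erase j)
        (Finset.disjoint_insert_right.2 ⟨hji, hSU.mono_left (Finset.erase_subset j S)⟩)
        (by rw [Finset.card_erase_of_mem hjS, hS, Nat.add_sub_cancel])
      rw [← Finset.add_sum_erase S a hjS, ← Finset.add_sum_erase S b hjS]
      omega

theorem IsStarFamily.alphaDeg_symbolicPower_le [Finite σ] {h : ℕ} (hF : IsStarFamily F h)
    (hF0 : ∀ i, F i ≠ 0) {d : ι → ℕ} (hd : ∀ i, (F i).IsHomogeneous (d i)) {m : ℕ} {b : ι → ℕ}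
    (hb : ∀ S : Finset ι, S.card = h → m ≤ ∑ i ∈ S, b i) :
    alphaDeg (symbolicPower (starIdeal F h) m) ≤ ∑ i, b i * d i :=
  Nat.sInf_le ⟨_, hF.prod_pow_mem_symbolicPower hb,
    Finset.prod_ne_zero_iff.2 fun i _ => pow_ne_zero _ (hF0 i), isHomogeneous_prod_pow hd b⟩

theorem IsStarFamily.exists_le_alphaDeg_symbolicPower [Finite σ] {h : ℕ} (hF : IsStarFamily F h)
    (hh : 1 ≤ h) (hcard : h ≤ Fintype.card ι) (hF0 : ∀ i, F i ≠ 0) {d : ι → ℕ}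
    (hd : ∀ i, (F i).IsHomogeneous (d i)) (hpos : ∀ i, 1 ≤ d i) (m : ℕ) :
    ∃ a : ι → ℕ, (∀ S : Finset ι, S.card = h → m ≤ ∑ i ∈ S, a i) ∧
      ∑ i, a i * d i ≤ alphaDeg (symbolicPower (starIdeal F h) m) := by
  have hne : {e | ∃ f ∈ symbolicPower (starIdeal F h) m, f ≠ 0 ∧ f.IsHomogeneous e}.Nonempty :=
    ⟨_, _, hF.prod_pow_mem_symbolicPower (b := fun _ => m)
      (fun S hS => by simpa [hS] using Nat.le_mul_of_pos_left m hh),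
      Finset.prod_ne_zero_iff.2 fun i _ => pow_ne_zero _ (hF0 i), isHomogeneous_prod_pow hd _⟩
  obtain ⟨f, hfI, hf0, hf⟩ := Nat.sInf_mem hne
  obtain ⟨b, hbe, hb⟩ := hF.exists_exponents hcard hd hpos h ∅ (by simp) m _ 0 f hf
    (by simpa using hf0) (fun S _ hS => by simpa using hF.symbolicPower_le hS m hfI)
  exact ⟨b, fun S hS => by simpa using hb S (Finset.disjoint_empty_right S) hS, hbe⟩

end Degree

/-- Regularity of all short sequences of distinct members makes `F` a star family. -/
lemma isStarFamily_of_isRegular {A ι : Type*} [CommRing A] {F : ι → A} {h : ℕ}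
    (hF : ∀ l : List ι, l.Nodup → l.length ≤ h + 1 →
      RingTheory.Sequence.IsRegular A (l.map F)) : IsStarFamily F h := by
  classical
  intro T hT i hi g hg
  have h1 := (hF (T.toList ++ [i])
    (List.nodup_append.2 ⟨T.nodup_toList, List.nodup_singleton i, by
      rintro a ha b hb rfl
      rw [List.mem_singleton] at hb
      exact hi (hb ▸ Finset.mem_toList.1 ha)⟩) (by simpa using hT)).toIsWeaklyRegular
  rw [List.map_append, RingTheory.Sequence.isWeaklyRegular_append_iff] at h1
  have h2 := ((RingTheory.Sequence.isWeaklyRegular_cons_iff _ _ _).1 h1.2).1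
  have hspan : (Ideal.ofList (T.toList.map F) • ⊤ : Submodule A A) = Ideal.span (F '' T) := by
    rw [smul_eq_mul, Ideal.mul_top]
    refine congrArg Ideal.span (Set.ext fun x => ?_)
    simp
  rw [hspan] at h2
  rw [← Ideal.Quotient.eq_zero_iff_mem]
  refine h2.right_eq_zero_of_smul ?_
  rw [Algebra.smul_def, Ideal.Quotient.algebraMap_eq, ← map_mul]
  exact Ideal.Quotient.eq_zero_iff_mem.2 hg

/-- **Corollary `cor.DemaillySC` (Demailly-like bound).** Let `I` be the defining ideal of a
codimension `h` star configuration in `ℙ^N_k` given by homogeneous forms `F_1,…,F_n` any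
`h+1` of which form a complete intersection (regular sequence).  Then for all `n', m ≥ 1`,
`(m+h−1)·α(I^{(n')}) ≥ n'·(α(I^{(m)}) + h − 1)`. -/
theorem stmt_11 {k : Type*} [Field k] (N n h : ℕ) (hh : 1 ≤ h) (hhN : h ≤ N) (hhn : h ≤ n)
    (F : Fin n → MvPolynomial (Fin (N + 1)) k)
    (hFhom : ∀ i, ∃ d, MvPolynomial.IsHomogeneous (F i) d)
    (hCI : ∀ l : List (Fin n), l.Nodup → l.length ≤ h + 1 →
      RingTheory.Sequence.IsRegular (MvPolynomial (Fin (N + 1)) k) (l.map F))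
    (I : Ideal (MvPolynomial (Fin (N + 1)) k))
    (hI : I = ⨅ (S : Finset (Fin n)) (_ : S.card = h), Ideal.span (F '' ↑S)) :
    ∀ n' m : ℕ, 1 ≤ n' → 1 ≤ m →
      n' * (alphaDeg (symbolicPower I m) + h - 1) ≤
        (m + h - 1) * alphaDeg (symbolicPower I n') := by
  subst hI
  intro n' m hn' hm
  have hF : IsStarFamily F h := isStarFamily_of_isRegular hCI
  choose d hd using hFhom
  have hsingle (i : Fin n) := hCI [i] (List.nodup_singleton i) (by simp)
  have hF0 (i : Fin n) : F i ≠ 0 := fun h0 => by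
    have := ((RingTheory.Sequence.isWeaklyRegular_cons_iff _ _ _).1
      (hsingle i).toIsWeaklyRegular).1
    rw [h0] at this
    exact one_ne_zero (this.right_eq_zero_of_smul
      (zero_smul _ (1 : MvPolynomial (Fin (N + 1)) k)))
  have hpos (i : Fin n) : 1 ≤ d i := by
    rw [Nat.one_le_iff_ne_zero]
    intro h0
    have htop := (hsingle i).top_ne_smul
    have hC := hd i
    rw [h0, ← MvPolynomial.mem_homogeneousSubmodule, MvPolynomial.homogeneousSubmodule_zero,
      Submodule.mem_one] at hC
    obtain ⟨c, hc⟩ := hC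
    have hc0 : c ≠ 0 := fun h => hF0 i (by rw [← hc, h, map_zero])
    apply htop
    rw [List.map_cons, List.map_nil, Ideal.ofList_singleton, Ideal.span_singleton_eq_top.2,
      smul_eq_mul, Ideal.mul_top]
    rw [← hc]
    exact (IsUnit.mk0 c hc0).map _
  have hcard : h ≤ Fintype.card (Fin n) := by simpa using hhn
  obtain ⟨a, ha, haα⟩ := hF.exists_le_alphaDeg_symbolicPower hh hcard hF0 hd hpos n'
  obtain ⟨b, hba, hb, hsum⟩ := exists_scaled_approximation hh hcard hm hn' ha
  have hα := hF.alphaDeg_symbolicPower_le hF0 hd hb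
  change n' * (alphaDeg (symbolicPower (starIdeal F h) m) + h - 1) ≤
    (m + h - 1) * alphaDeg (symbolicPower (starIdeal F h) n')
  have hweight : (m + h - 1) * ∑ i, a i + n' * ∑ i, b i * d i ≤
      (m + h - 1) * ∑ i, a i * d i + n' * ∑ i, b i := by
    simp only [Finset.mul_sum, ← Finset.sum_add_distrib]
    refine Finset.sum_le_sum fun i _ => ?_
    obtain ⟨c, hc⟩ := Nat.exists_eq_add_of_le' (hpos i)
    rw [hc]
    nlinarith [Nat.mul_le_mul_right c (hba i)]
  have hα' := Nat.mul_le_mul_left n' hα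
  have haα' := Nat.mul_le_mul_left (m + h - 1) haα
  rw [Nat.add_sub_assoc hh, mul_add] at hsum ⊢
  linarith
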